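/- Let m and n be natural numbers, let δ be a real number, and let r, t : Fin m → Fin n → ℝ be such that for every j in Fin m, both r j and t j are sorted in non-ascending order (antitone). If δ < ∑_{j} ∑_{i} max(r j i − t j i, 0), then for every family of permutations σ_j of Fin n indexed by j in Fin m, δ < ∑_{j} ∑_{i} max(r j i − t j (σ_j i), 0). (Graph-level GND lower bound pruning for the SUM aggregate: if the GND lower bound of a candidate subgraph exceeds the threshold δ, then its generalized neighbor difference under every possible matching exceeds δ, so the candidate subgraph can be safely pruned.) -/

import Mathlib

lemma gnd_exchange (a b c d : ℝ) (h1 : b ≤ a) (h2 : d ≤ c) :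
    max (a - c) 0 + max (b - d) 0 ≤ max (a - d) 0 + max (b - c) 0 := by
  rcases max_cases (a - c) 0 with h | h <;> rcases max_cases (b - d) 0 with h' | h' <;>
  rcases max_cases (a - d) 0 with h'' | h'' <;> rcases max_cases (b - c) 0 with h''' | h''' <;>
  linarith

lemma gnd_single (n : ℕ) (f g : Fin n → ℝ) (hf : Antitone f) (hg : Antitone g)
    (σ : Equiv.Perm (Fin n)) :
    ∑ i, max (f i - g i) 0 ≤ ∑ i, max (f i - g (σ i)) 0 := by
  induction n with
  | zero => simp
  | succ n ih =>
    obtain ⟨⟨p, e⟩, rfl⟩ := Equiv.Perm.decomposeFin.symm.surjective σ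
    have hi := ih (fun i => f i.succ) (fun i => g i.succ)
      (fun i j h => hf (Fin.succ_le_succ_iff.2 h)) (fun i j h => hg (Fin.succ_le_succ_iff.2 h)) e
    rw [Fin.sum_univ_succ, Fin.sum_univ_succ]
    simp only [Equiv.Perm.decomposeFin_symm_apply_zero, Equiv.Perm.decomposeFin_symm_apply_succ]
    cases p using Fin.cases with
    | zero => simpa using hi
    | succ q =>
      rw [← Finset.add_sum_erase Finset.univ (fun i => max (f i.succ - g (e i).succ) 0)
        (Finset.mem_univ (e.symm q))] at hi
      rw [← Finset.add_sum_erase Finset.univ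
        (fun i : Fin n => max (f i.succ - g (Equiv.swap 0 q.succ (e i).succ)) 0)
        (Finset.mem_univ (e.symm q))]
      have hs : ∑ i ∈ Finset.univ.erase (e.symm q),
          max (f i.succ - g (Equiv.swap 0 q.succ (e i).succ)) 0 =
          ∑ i ∈ Finset.univ.erase (e.symm q), max (f i.succ - g (e i).succ) 0 := by
        refine Finset.sum_congr rfl fun i hi => ?_
        have hne : (e i).succ ≠ q.succ := by
          intro h
          have h2 := Fin.succ_injective _ h
          exact (Finset.mem_erase.1 hi).1 (by simp [← h2])
        rw [Equiv.swap_apply_of_ne_of_ne (Fin.succ_ne_zero _) hne]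
      rw [hs]
      have hx := gnd_exchange (f 0) (f (e.symm q).succ) (g 0) (g q.succ)
        (hf (Fin.zero_le _)) (hg (Fin.zero_le _))
      simp only [Equiv.apply_symm_apply, Equiv.swap_apply_right] at hi ⊢
      linarith


/-- Graph-level GND lower bound pruning for the SUM aggregate: if the GND
lower bound exceeds the threshold δ, then the generalized neighbor difference
under every possible matching exceeds δ. -/
theorem gnd_sum_lowerBound_pruning (m n : ℕ) (δ : ℝ) (r t : Fin m → Fin n → ℝ)
    (hr : ∀ j, Antitone (r j)) (ht : ∀ j, Antitone (t j))
    (hδ : δ < ∑ j, ∑ i, max (r j i - t j i) 0)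
    (σ : Fin m → Equiv.Perm (Fin n)) :
    δ < ∑ j, ∑ i, max (r j i - t j (σ j i)) 0 := by

  exact lt_of_lt_of_le hδ (Finset.sum_le_sum fun j _ => gnd_single n (r j) (t j) (hr j) (ht j) (σ j))
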